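/- Let S be a Lalley–Gatzouras carpet, let i_* be an index attaining the maximum in the definition of β_x, let C_x ⊆ [0,1] be the attractor of the maps T_j(x) = a_{i_* j}x + c_{i_* j} for 1 ≤ j ≤ n_{i_*} (that is, C_x = ⋂_{k≥1} ⋃_{w ∈ {1,…,n_{i_*}}^k} (T_{w_1} ∘ ⋯ ∘ T_{w_k})([0,1])), and let C_y ⊆ [0,1] be the attractor of the maps y ↦ b_i y + d_i for 1 ≤ i ≤ m. Then S has a weak tangent containing a bi-Lipschitz copy of C_x × C_y: there exist a compact set X ⊆ ℝ², a sequence of similarity transformations f_k of ℝ² (maps with |f_k(a) − f_k(b)| = λ_k|a − b| for all a, b, for some λ_k > 0), and a compact set W ⊆ X such that f_k(S) ∩ X converges to W in the Hausdorff distance, together with an injective map h : C_x × C_y → W and a constant L ≥ 1 such that L^{-1}|a − b| ≤ |h(a) − h(b)| ≤ L|a − b| for all a, b ∈ C_x × C_y. -/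

import Mathlib

open Set Metric Filter

/-- The Assouad dimension of a set `E` in a metric space: the infimum of all `α ≥ 0`
for which there is `C > 0` such that for every `x ∈ E` and all radii `0 < r ≤ R`,
the set `E ∩ B(x, R)` can be covered by at most `C · (R / r) ^ α` balls of radius `r`. -/
noncomputable def assouadDim {X : Type*} [PseudoMetricSpace X] (E : Set X) : ℝ :=
  sInf { α : ℝ | 0 ≤ α ∧ ∃ C : ℝ, 0 < C ∧ ∀ x ∈ E, ∀ r R : ℝ, 0 < r → r ≤ R →
    ∃ F : Finset X, (F.card : ℝ) ≤ C * (R / r) ^ α ∧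
      E ∩ Metric.ball x R ⊆ ⋃ y ∈ F, Metric.ball y r }

/-- The defining data of a Lalley–Gatzouras carpet: `m ≥ 2` rows, the `i`-th row
(for `0 ≤ i < m`) containing `n i ≥ 1` affine maps `A_{ij}(x,y) = (a i j • x + c i j, b i • y + d i)`
(for `0 ≤ j < n i`), with at least one row containing at least two maps, each map contracting
strictly more horizontally than vertically, the rows stacked disjointly in order inside `[0,1]`
vertically, and the maps of each row placed disjointly in order inside `[0,1]` horizontally. -/
structure LGData where
  m : ℕ
  n : ℕ → ℕ
  a : ℕ → ℕ → ℝ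
  b : ℕ → ℝ
  c : ℕ → ℕ → ℝ
  d : ℕ → ℝ
  hm : 2 ≤ m
  hn_one : ∀ i, i < m → 1 ≤ n i
  hn_two : ∃ i, i < m ∧ 2 ≤ n i
  ha_pos : ∀ i, i < m → ∀ j, j < n i → 0 < a i j
  ha_lt_b : ∀ i, i < m → ∀ j, j < n i → a i j < b i
  hb_lt_one : ∀ i, i < m → b i < 1
  hd_nonneg : 0 ≤ d 0
  hd_gap : ∀ i, i + 1 < m → d i + b i ≤ d (i + 1)
  hd_top : d (m - 1) + b (m - 1) ≤ 1
  hc_nonneg : ∀ i, i < m → 0 ≤ c i 0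
  hc_gap : ∀ i, i < m → ∀ j, j + 1 < n i → c i j + a i j ≤ c i (j + 1)
  hc_top : ∀ i, i < m → c i (n i - 1) + a i (n i - 1) ≤ 1

/-- The affine map `A_{ij}(x, y) = (a_{ij} x + c_{ij}, b_i y + d_i)`. -/
def lgMap (D : LGData) (ij : ℕ × ℕ) (p : ℝ × ℝ) : ℝ × ℝ :=
  (D.a ij.1 ij.2 * p.1 + D.c ij.1 ij.2, D.b ij.1 * p.2 + D.d ij.1)

/-- The composition `A_{ω_1} ∘ ⋯ ∘ A_{ω_k}` along a word `ω`. -/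
def lgWordMap (D : LGData) : List (ℕ × ℕ) → ℝ × ℝ → ℝ × ℝ
  | [] => id
  | ij :: w => lgMap D ij ∘ lgWordMap D w

/-- The plane `ℝ²` with the Euclidean metric, identifying a pair with a Euclidean point. -/
noncomputable def toE (p : ℝ × ℝ) : EuclideanSpace ℝ (Fin 2) :=
  (WithLp.equiv 2 (Fin 2 → ℝ)).symm ![p.1, p.2]

/-- The Lalley–Gatzouras carpet: the limit set
`S = ⋂_{k ≥ 1} ⋃_{ω ∈ 𝒥^k} (A_{ω_1} ∘ ⋯ ∘ A_{ω_k})([0,1]²)`, as a subset of the Euclidean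
plane. -/
def lgCarpet (D : LGData) : Set (EuclideanSpace ℝ (Fin 2)) :=
  ⋂ k ∈ {k : ℕ | 1 ≤ k},
    ⋃ w ∈ {w : List (ℕ × ℕ) | w.length = k ∧ ∀ ij ∈ w, ij.1 < D.m ∧ ij.2 < D.n ij.1},
      (fun p : ℝ × ℝ => toE (lgWordMap D w p)) '' (Set.Icc (0 : ℝ) 1 ×ˢ Set.Icc (0 : ℝ) 1)

/-- Composition of the horizontal maps `T_j(x) = a_{i* j} x + c_{i* j}` along a word. -/
def lgXWordMap (D : LGData) (istar : ℕ) : List ℕ → ℝ → ℝ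
  | [] => id
  | j :: w => (fun x => D.a istar j * x + D.c istar j) ∘ lgXWordMap D istar w

/-- Composition of the vertical maps `y ↦ b_i y + d_i` along a word. -/
def lgYWordMap (D : LGData) : List ℕ → ℝ → ℝ
  | [] => id
  | i :: w => (fun y => D.b i * y + D.d i) ∘ lgYWordMap D w

/-- `C_x`: the attractor of the maps `T_j(x) = a_{i* j} x + c_{i* j}`, `0 ≤ j < n i*`. -/
def lgCx (D : LGData) (istar : ℕ) : Set ℝ :=
  ⋂ k ∈ {k : ℕ | 1 ≤ k},
    ⋃ w ∈ {w : List ℕ | w.length = k ∧ ∀ j ∈ w, j < D.n istar},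
      lgXWordMap D istar w '' Set.Icc (0 : ℝ) 1

/-- `C_y`: the attractor of the maps `y ↦ b_i y + d_i`, `0 ≤ i < m`. -/
def lgCy (D : LGData) : Set ℝ :=
  ⋂ k ∈ {k : ℕ | 1 ≤ k},
    ⋃ w ∈ {w : List ℕ | w.length = k ∧ ∀ i ∈ w, i < D.m},
      lgYWordMap D w '' Set.Icc (0 : ℝ) 1

/-- Consecutive intervals `[u j, u j + v j]` placed in order inside `[0, 1]` all lie in `[0, 1]`. -/
theorem consecutive_intervals_subset_unit {u v : ℕ → ℝ} {N : ℕ} (hv : ∀ j, j < N → 0 < v j)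
    (h0 : 0 ≤ u 0) (hgap : ∀ j, j + 1 < N → u j + v j ≤ u (j + 1))
    (htop : u (N - 1) + v (N - 1) ≤ 1) {j : ℕ} (hj : j < N) : 0 ≤ u j ∧ u j + v j ≤ 1 := by
  constructor
  · clear htop
    induction j with
    | zero => exact h0
    | succ j ih => linarith [ih (by omega), hgap j hj, hv j (by omega)]
  · have key : ∀ k, j ≤ k → k < N → u j + v j ≤ u k + v k := by
      intro k hjk
      induction k, hjk using Nat.le_induction with
      | base => intro _; exact le_rfl
      | succ k _ ih => intro hk; linarith [ih (by omega), hgap k hk, hv (k + 1) hk]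
    exact (key (N - 1) (by omega) (by omega)).trans htop

theorem mul_add_mem_unit {a c x : ℝ} (ha : 0 < a) (hc : 0 ≤ c ∧ c + a ≤ 1)
    (hx : x ∈ Icc (0 : ℝ) 1) : a * x + c ∈ Icc (0 : ℝ) 1 :=
  ⟨by nlinarith [hx.1], by nlinarith [hx.2]⟩

theorem iterate_mul_add (a c : ℝ) (k : ℕ) (x : ℝ) :
    (fun t => a * t + c)^[k] x = a ^ k * x + (fun t => a * t + c)^[k] 0 := by
  induction k with
  | zero => simp
  | succ k ih => rw [Function.iterate_succ_apply', Function.iterate_succ_apply', ih]; ring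

namespace LGData

variable (D : LGData)

theorem b_pos {i : ℕ} (hi : i < D.m) : 0 < D.b i :=
  (D.ha_pos i hi 0 (D.hn_one i hi)).trans (D.ha_lt_b i hi 0 (D.hn_one i hi))

theorem row_subset_unit {i : ℕ} (hi : i < D.m) : 0 ≤ D.d i ∧ D.d i + D.b i ≤ 1 :=
  consecutive_intervals_subset_unit (fun _ hj => D.b_pos hj) D.hd_nonneg D.hd_gap D.hd_top hi

theorem column_subset_unit {i j : ℕ} (hi : i < D.m) (hj : j < D.n i) :
    0 ≤ D.c i j ∧ D.c i j + D.a i j ≤ 1 :=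
  consecutive_intervals_subset_unit (D.ha_pos i hi) (D.hc_nonneg i hi) (D.hc_gap i hi)
    (D.hc_top i hi) hj

/-- The index set of the maps of the carpet. -/
def index : Set (ℕ × ℕ) := {ij | ij.1 < D.m ∧ ij.2 < D.n ij.1}

theorem finite_index : D.index.Finite := by
  have h : D.index ⊆ ⋃ i ∈ Iio D.m, {i} ×ˢ Iio (D.n i) := by
    rintro ⟨i, j⟩ ⟨hi, hj⟩
    simp only [mem_iUnion]
    exact ⟨i, hi, rfl, hj⟩
  exact ((finite_Iio _).biUnion fun i _ => (finite_singleton i).prod (finite_Iio _)).subset h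

/-- The closed unit square. -/
def square : Set (ℝ × ℝ) := Icc (0 : ℝ) 1 ×ˢ Icc (0 : ℝ) 1

/-- The union of the level `k` cylinder rectangles of the carpet. -/
def level (k : ℕ) : Set (ℝ × ℝ) :=
  ⋃ w ∈ {w : List (ℕ × ℕ) | w.length = k ∧ ∀ ij ∈ w, ij ∈ D.index}, image (lgWordMap D w) square

/-- The carpet as a subset of `ℝ × ℝ`. -/
def attractor : Set (ℝ × ℝ) := ⋂ k, D.level k

theorem mem_level {k : ℕ} {p : ℝ × ℝ} : p ∈ D.level k ↔
    ∃ w : List (ℕ × ℕ), w.length = k ∧ (∀ ij ∈ w, ij ∈ D.index) ∧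
      ∃ q ∈ square, lgWordMap D w q = p := by
  simp only [level, mem_iUnion, mem_image, exists_prop, Set.mem_ofPred_eq, and_assoc]

theorem level_zero : D.level 0 = square := by
  ext p
  simp only [mem_level, List.length_eq_zero_iff]
  constructor
  · rintro ⟨w, rfl, -, q, hq, rfl⟩
    exact hq
  · intro hp
    exact ⟨[], rfl, by simp, p, hp, rfl⟩

theorem level_succ (k : ℕ) : D.level (k + 1) = ⋃ ij ∈ D.index, lgMap D ij '' D.level k := by
  ext p
  simp only [mem_iUnion, mem_image, exists_prop]
  constructor
  · intro hp
    obtain ⟨w, hw, hwi, q, hq, rfl⟩ := D.mem_level.1 hp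
    match w, hw, hwi with
    | ij :: w, hw, hwi =>
      refine ⟨ij, hwi ij (by simp), lgWordMap D w q,
        D.mem_level.2 ⟨w, by simpa using hw, ?_, q, hq, rfl⟩, rfl⟩
      exact fun x hx => hwi x (by simp [hx])
  · rintro ⟨ij, hij, p, hp, rfl⟩
    obtain ⟨w, hw, hwi, q, hq, rfl⟩ := D.mem_level.1 hp
    refine D.mem_level.2 ⟨ij :: w, by simp [hw], ?_, q, hq, rfl⟩
    exact List.forall_mem_cons.2 ⟨hij, hwi⟩

theorem continuous_lgMap (ij : ℕ × ℕ) : Continuous (lgMap D ij) := by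
  unfold lgMap; fun_prop

theorem lgMap_mem_square {ij : ℕ × ℕ} (hij : ij ∈ D.index) {p : ℝ × ℝ} (hp : p ∈ square) :
    lgMap D ij p ∈ square :=
  ⟨mul_add_mem_unit (D.ha_pos _ hij.1 _ hij.2) (D.column_subset_unit hij.1 hij.2) hp.1,
    mul_add_mem_unit (D.b_pos hij.1) (D.row_subset_unit hij.1) hp.2⟩

theorem isCompact_level (k : ℕ) : IsCompact (D.level k) := by
  induction k with
  | zero => rw [level_zero]; exact isCompact_Icc.prod isCompact_Icc
  | succ k ih =>
    rw [level_succ]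
    exact D.finite_index.isCompact_biUnion fun ij _ => ih.image (D.continuous_lgMap ij)

theorem level_succ_subset (k : ℕ) : D.level (k + 1) ⊆ D.level k := by
  induction k with
  | zero =>
    rw [level_succ, level_zero]
    exact iUnion₂_subset fun ij hij => image_subset_iff.2 fun p hp => D.lgMap_mem_square hij hp
  | succ k ih =>
    calc D.level (k + 1 + 1) = ⋃ ij ∈ D.index, lgMap D ij '' D.level (k + 1) := D.level_succ _
      _ ⊆ ⋃ ij ∈ D.index, lgMap D ij '' D.level k := iUnion₂_mono fun ij _ => image_mono ih
      _ = D.level (k + 1) := (D.level_succ k).symm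

theorem isCompact_attractor : IsCompact D.attractor :=
  (D.isCompact_level 0).of_isClosed_subset
    (isClosed_iInter fun k => (D.isCompact_level k).isClosed) (iInter_subset _ 0)

theorem lgMap_mem_attractor {ij : ℕ × ℕ} (hij : ij ∈ D.index) {p : ℝ × ℝ}
    (hp : p ∈ D.attractor) : lgMap D ij p ∈ D.attractor := by
  refine mem_iInter.2 fun k => D.level_succ_subset k ?_
  rw [level_succ]
  exact mem_biUnion hij ⟨p, mem_iInter.1 hp k, rfl⟩

theorem lgWordMap_mem_attractor {w : List (ℕ × ℕ)} (hw : ∀ ij ∈ w, ij ∈ D.index) {p : ℝ × ℝ}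
    (hp : p ∈ D.attractor) : lgWordMap D w p ∈ D.attractor := by
  induction w with
  | nil => exact hp
  | cons ij w ih =>
    exact D.lgMap_mem_attractor (hw ij (by simp)) (ih fun x hx => hw x (by simp [hx]))

theorem lgWordMap_map_snd (w : List ℕ) (p : ℝ × ℝ) :
    (lgWordMap D (w.map fun i => (i, 0)) p).2 = lgYWordMap D w p.2 := by
  induction w with
  | nil => rfl
  | cons i w ih => simp [lgWordMap, lgYWordMap, lgMap, ih]

theorem exists_mem_attractor_snd_eq {y : ℝ} (hy : y ∈ lgCy D) : ∃ x, (x, y) ∈ D.attractor := by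
  have hclosed : IsClosed {p : ℝ × ℝ | p.2 = y} := isClosed_eq continuous_snd continuous_const
  have hne : ∀ k, (D.level (k + 1) ∩ {p | p.2 = y}).Nonempty := by
    intro k
    have hyk := mem_iInter₂.1 hy (k + 1) (Nat.succ_pos k)
    simp only [mem_iUnion, mem_image, exists_prop] at hyk
    obtain ⟨w, ⟨hw, hwi⟩, t, ht, rfl⟩ := hyk
    refine ⟨lgWordMap D (w.map fun i => (i, 0)) (0, t), D.mem_level.2
      ⟨_, by simpa using hw, ?_, (0, t), ⟨by simp, ht⟩, rfl⟩, D.lgWordMap_map_snd w (0, t)⟩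
    intro ij hij
    obtain ⟨i, hi, rfl⟩ := List.mem_map.1 hij
    exact ⟨hwi i hi, D.hn_one i (hwi i hi)⟩
  obtain ⟨⟨x, y'⟩, hp⟩ := IsCompact.nonempty_iInter_of_sequence_nonempty_isCompact_isClosed
    (fun k => D.level k ∩ {p | p.2 = y})
    (fun k => inter_subset_inter_left _ (D.level_succ_subset k))
    (fun k => (hne k).mono (inter_subset_inter_left _ (D.level_succ_subset k)))
    ((D.isCompact_level 0).inter_right hclosed)
    (fun k => (D.isCompact_level k).isClosed.inter hclosed)
  have hp' := mem_iInter.1 hp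
  obtain rfl : y' = y := (hp' 0).2
  exact ⟨x, mem_iInter.2 fun k => (hp' k).1⟩

theorem lgCarpet_eq_image : lgCarpet D = toE '' D.attractor := by
  have hinj : Function.Injective toE := by
    intro p q h
    have h' : ![p.1, p.2] = ![q.1, q.2] := (WithLp.equiv 2 (Fin 2 → ℝ)).symm.injective h
    exact Prod.ext (congrFun h' 0) (congrFun h' 1)
  have hlevel : ∀ k, (⋃ w ∈ {w : List (ℕ × ℕ) | w.length = k ∧
      ∀ ij ∈ w, ij.1 < D.m ∧ ij.2 < D.n ij.1}, (fun p : ℝ × ℝ => toE (lgWordMap D w p)) ''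
        (Icc (0 : ℝ) 1 ×ˢ Icc (0 : ℝ) 1)) = toE '' D.level k := by
    intro k
    simp only [level, image_iUnion, image_image]
    rfl
  unfold lgCarpet
  simp only [hlevel]
  ext z
  simp only [mem_iInter, Set.mem_ofPred_eq]
  constructor
  · intro h
    obtain ⟨p, -, rfl⟩ := h 1 le_rfl
    refine ⟨p, mem_iInter.2 fun k => ?_, rfl⟩
    obtain ⟨q, hq, hqp⟩ := h (k + 1) (by omega)
    exact hinj hqp ▸ D.level_succ_subset k hq
  · rintro ⟨p, hp, rfl⟩ k -
    exact ⟨p, mem_iInter.1 hp k, rfl⟩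

theorem lgXWordMap_append (i : ℕ) (u w : List ℕ) (x : ℝ) :
    lgXWordMap D i (u ++ w) x = lgXWordMap D i u (lgXWordMap D i w x) := by
  induction u with
  | nil => rfl
  | cons j u ih => simp [lgXWordMap, ih]

theorem lgXWordMap_replicate (i j k : ℕ) (x : ℝ) :
    lgXWordMap D i (List.replicate k j) x = (fun t => D.a i j * t + D.c i j)^[k] x := by
  induction k with
  | zero => rfl
  | succ k ih => rw [Function.iterate_succ_apply', ← ih]; rfl

theorem lgWordMap_map_row (i : ℕ) (w : List ℕ) (p : ℝ × ℝ) :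
    lgWordMap D (w.map fun j => (i, j)) p =
      (lgXWordMap D i w p.1, (fun t => D.b i * t + D.d i)^[w.length] p.2) := by
  induction w with
  | nil => rfl
  | cons j w ih =>
    rw [List.length_cons, Function.iterate_succ_apply']
    simp [lgWordMap, lgXWordMap, lgMap, ih]

variable {D}

theorem lgXWordMap_mem_unit {i : ℕ} (hi : i < D.m) {w : List ℕ} (hw : ∀ j ∈ w, j < D.n i)
    {x : ℝ} (hx : x ∈ Icc (0 : ℝ) 1) : lgXWordMap D i w x ∈ Icc (0 : ℝ) 1 := by
  induction w with
  | nil => exact hx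
  | cons j w ih =>
    have hj : j < D.n i := hw j (by simp)
    exact mul_add_mem_unit (D.ha_pos i hi j hj) (D.column_subset_unit hi hj)
      (ih fun k hk => hw k (by simp [hk]))

theorem abs_lgXWordMap_sub_le {i : ℕ} (hi : i < D.m) {w : List ℕ} (hw : ∀ j ∈ w, j < D.n i)
    (x y : ℝ) : |lgXWordMap D i w x - lgXWordMap D i w y| ≤ D.b i ^ w.length * |x - y| := by
  induction w with
  | nil => simp [lgXWordMap]
  | cons j w ih =>
    have hj : j < D.n i := hw j (by simp)
    have h1 : lgXWordMap D i (j :: w) x - lgXWordMap D i (j :: w) y =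
        D.a i j * (lgXWordMap D i w x - lgXWordMap D i w y) := by
      simp only [lgXWordMap, Function.comp_apply]; ring
    rw [h1, abs_mul, abs_of_pos (D.ha_pos i hi j hj), List.length_cons, pow_succ', mul_assoc]
    exact mul_le_mul (D.ha_lt_b i hi j hj).le (ih fun k hk => hw k (by simp [hk]))
      (abs_nonneg _) (D.b_pos hi).le

theorem exists_lgXWordMap_eq {i : ℕ} (hi : i < D.m) {x : ℝ} (hx : x ∈ lgCx D i) (k : ℕ) :
    ∃ w : List ℕ, w.length = k ∧ (∀ j ∈ w, j < D.n i) ∧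
      ∃ t ∈ Icc (0 : ℝ) 1, lgXWordMap D i w t = x := by
  have hpos : ∀ k, 1 ≤ k → ∃ w : List ℕ, w.length = k ∧ (∀ j ∈ w, j < D.n i) ∧
      ∃ t ∈ Icc (0 : ℝ) 1, lgXWordMap D i w t = x := by
    intro k hk
    have hxk := mem_iInter₂.1 hx k hk
    simp only [mem_iUnion, mem_image, exists_prop] at hxk
    obtain ⟨w, ⟨hw, hwi⟩, h⟩ := hxk
    exact ⟨w, hw, hwi, h⟩
  rcases k.eq_zero_or_pos with rfl | hk
  · obtain ⟨w, -, hwi, t, ht, rfl⟩ := hpos 1 le_rfl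
    exact ⟨[], rfl, by simp, _, lgXWordMap_mem_unit hi hwi ht, rfl⟩
  · exact hpos k hk

end LGData

theorem continuous_toE : Continuous toE := by
  refine (PiLp.continuous_toLp 2 _).comp (continuous_pi fun i => ?_)
  fin_cases i
  · exact continuous_fst
  · exact continuous_snd

theorem toE_sub (p q : ℝ × ℝ) : toE p - toE q = toE (p - q) := by
  ext i; fin_cases i <;> simp [toE]

theorem smul_toE (r : ℝ) (p : ℝ × ℝ) : r • toE p = toE (r • p) := by
  ext i; fin_cases i <;> simp [toE]

/-- At every scale, a suitable similarity maps the carpet so close to a vertically rescaled copy of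
`C_x × C_y` that each point of that copy is approximated inside the unit square. The vertical
factor `s` stays in the fixed interval `[b_i, 1]`. -/
theorem LGData.exists_magnification (D : LGData) {i : ℕ} (hi : i < D.m) (l : ℕ) :
    ∃ r : ℝ, 0 < r ∧ ∃ v : ℝ × ℝ, ∃ s ∈ Icc (D.b i) 1,
      ∀ x ∈ lgCx D i, ∀ y ∈ lgCy D, ∃ x' : ℝ, |x' - x| ≤ (D.a i 0 / D.b i) ^ l ∧
        toE (x', s * y) ∈ (fun z => r • (z - toE v)) '' lgCarpet D ∩ toE '' square := by
  have h0 : 0 < D.n i := D.hn_one i hi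
  have ha := D.ha_pos i hi 0 h0
  have hab := D.ha_lt_b i hi 0 h0
  have hb := D.b_pos hi
  have hb1 := D.hb_lt_one i hi
  have hal : 0 < D.a i 0 ^ l := pow_pos ha l
  obtain ⟨q, hq1, hq2⟩ := exists_nat_pow_near_of_lt_one hal
    (pow_le_one₀ ha.le (hab.trans hb1).le) hb hb1
  have hlq : l ≤ q + 1 := by
    by_contra! h
    have h1 : D.b i ^ l ≤ D.b i ^ (q + 1) := pow_le_pow_of_le_one hb.le hb1.le h.le
    have h2 : D.a i 0 ^ l ≤ D.b i ^ l := pow_le_pow_left₀ ha.le hab.le l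
    linarith
  obtain ⟨e, he⟩ := Nat.exists_eq_add_of_le hlq
  have hs : D.b i ^ (q + 1) / D.a i 0 ^ l ∈ Icc (D.b i) 1 := by
    constructor
    · rw [le_div_iff₀ hal, pow_succ']
      exact mul_le_mul_of_nonneg_left hq2 hb.le
    · exact (div_le_one hal).2 hq1.le
  refine ⟨(D.a i 0 ^ l)⁻¹, inv_pos.2 hal, ((fun t => D.a i 0 * t + D.c i 0)^[l] 0,
    (fun t => D.b i * t + D.d i)^[q + 1] 0), _, hs, fun x hx y hy => ?_⟩
  obtain ⟨x₀, hx₀⟩ := D.exists_mem_attractor_snd_eq hy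
  have hsq : (x₀, y) ∈ square := D.level_zero ▸ mem_iInter.1 hx₀ 0
  obtain ⟨w, hwl, hwi, t, ht, rfl⟩ := exists_lgXWordMap_eq hi hx e
  refine ⟨lgXWordMap D i w x₀, ?_, ⟨toE (lgWordMap D
    ((List.replicate l 0 ++ w).map fun j => (i, j)) (x₀, y)), ?_, ?_⟩, _, ⟨?_, ?_⟩, rfl⟩
  · have hdist : |x₀ - t| ≤ 1 := abs_sub_le_iff.2
      ⟨by linarith [hsq.1.2, ht.1], by linarith [hsq.1.1, ht.2]⟩
    calc |lgXWordMap D i w x₀ - lgXWordMap D i w t|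
        ≤ D.b i ^ w.length * |x₀ - t| := abs_lgXWordMap_sub_le hi hwi _ _
      _ ≤ D.b i ^ e := by
        rw [hwl]; exact mul_le_of_le_one_right (pow_nonneg hb.le _) hdist
      _ ≤ (D.a i 0 / D.b i) ^ l := by
        rw [div_pow, le_div_iff₀ (pow_pos hb l), ← pow_add, add_comm, ← he]
        exact hq1.le
  · rw [D.lgCarpet_eq_image]
    refine mem_image_of_mem _ (D.lgWordMap_mem_attractor ?_ hx₀)
    intro ij hij
    obtain ⟨j, hj, rfl⟩ := List.mem_map.1 hij
    refine ⟨hi, ?_⟩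
    rcases List.mem_append.1 hj with hj | hj
    · exact (List.eq_of_mem_replicate hj).symm ▸ h0
    · exact hwi j hj
  · have hlen : (List.replicate l 0 ++ w).length = q + 1 := by simp [hwl, he]
    simp only [toE_sub, smul_toE]
    congr 1
    rw [D.lgWordMap_map_row, hlen, D.lgXWordMap_append, D.lgXWordMap_replicate,
      iterate_mul_add _ _ l (lgXWordMap D i w x₀), iterate_mul_add _ _ (q + 1) y]
    ext
    · simp [hal.ne']
    · simp [div_eq_inv_mul, mul_assoc]
  · exact lgXWordMap_mem_unit hi hwi hsq.1
  · exact ⟨mul_nonneg (hb.le.trans hs.1) hsq.2.1, mul_le_one₀ hs.2 hsq.2.1 hsq.2.2⟩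

/-- A sequence of closed sets has a subsequence whose traces on a compact set `X` converge in the
Hausdorff distance, along which a given sequence in a compact interval converges as well. -/
theorem exists_subseq_tendsto_hausdorffEDist {E : Type*} [MetricSpace E] {X : Set E}
    (hX : IsCompact X) {K : ℕ → Set E} (hK : ∀ k, IsClosed (K k)) {a b : ℝ} {s : ℕ → ℝ}
    (hs : ∀ k, s k ∈ Icc a b) :
    ∃ W ⊆ X, IsCompact W ∧ ∃ t ∈ Icc a b, ∃ φ : ℕ → ℕ, StrictMono φ ∧
      Tendsto (fun k => hausdorffEDist (K (φ k) ∩ X) W) atTop (nhds 0) ∧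
      Tendsto (s ∘ φ) atTop (nhds t) := by
  let C : ℕ → TopologicalSpace.Compacts E := fun k => ⟨K k ∩ X, hX.inter_left (hK k)⟩
  obtain ⟨⟨W, t⟩, ⟨hW, ht⟩, φ, hφ, hlim⟩ :=
    ((TopologicalSpace.Compacts.isCompact_subsets_of_isCompact hX).prod
      (isCompact_Icc (a := a) (b := b))).tendsto_subseq (x := fun k => (C k, s k))
      (fun k => ⟨inter_subset_right, hs k⟩)
  rw [nhds_prod_eq] at hlim
  exact ⟨W, hW, W.isCompact, t, ht, φ, hφ,
    tendsto_iff_edist_tendsto_0.1 (tendsto_fst.comp hlim), tendsto_snd.comp hlim⟩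

theorem IsClosed.mem_of_tendsto_hausdorffEDist {E : Type*} [PseudoEMetricSpace E] {W : Set E}
    (hW : IsClosed W) {K : ℕ → Set E}
    (hK : Tendsto (fun k => hausdorffEDist (K k) W) atTop (nhds 0)) {p : ℕ → E} {x : E}
    (hp : ∀ k, p k ∈ K k) (hpx : Tendsto p atTop (nhds x)) : x ∈ W := by
  rw [mem_iff_infEDist_zero_of_closed hW, ← nonpos_iff_eq_zero]
  have hlim := (tendsto_iff_edist_tendsto_0.1 hpx).add hK
  rw [add_zero] at hlim
  refine ge_of_tendsto' hlim fun k => ?_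
  rw [edist_comm]
  exact infEDist_le_edist_add_infEDist.trans
    (add_le_add_right (infEDist_le_hausdorffEDist_of_mem (hp k)) _)

/-- Scaling the second coordinate by a factor `s ∈ (0, 1]` is bi-Lipschitz with constant `s⁻¹`. -/
theorem dist_toE_mul_snd {s : ℝ} (hs : 0 < s) (hs1 : s ≤ 1) (x y : EuclideanSpace ℝ (Fin 2)) :
    s * dist x y ≤ dist (toE (x 0, s * x 1)) (toE (y 0, s * y 1)) ∧
      dist (toE (x 0, s * x 1)) (toE (y 0, s * y 1)) ≤ dist x y := by
  have h1 : dist (toE (x 0, s * x 1)) (toE (y 0, s * y 1)) =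
      √((x 0 - y 0) ^ 2 + s ^ 2 * (x 1 - y 1) ^ 2) := by
    rw [EuclideanSpace.dist_eq]
    simp only [toE, Fin.sum_univ_two, Real.dist_eq, sq_abs]
    congr 1
    simp
    ring
  have h2 : dist x y = √((x 0 - y 0) ^ 2 + (x 1 - y 1) ^ 2) := by
    simp [EuclideanSpace.dist_eq, Real.dist_eq, sq_abs]
  have hsq : s ^ 2 ≤ 1 := pow_le_one₀ hs.le hs1
  rw [h1, h2]
  constructor
  · refine Real.le_sqrt_of_sq_le ?_
    rw [mul_pow, Real.sq_sqrt (by positivity)]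
    nlinarith [sq_nonneg (x 0 - y 0)]
  · refine Real.sqrt_le_sqrt ?_
    nlinarith [sq_nonneg (x 1 - y 1)]

/-- If `i*` attains the maximum in the definition of `β_x`, then the
Lalley–Gatzouras carpet `S` has a weak tangent containing a bi-Lipschitz copy of
`C_x × C_y`: there are a compact `X ⊆ ℝ²`, similarities `f k` of the plane (with ratios
`lam k > 0`) such that `f k '' S ∩ X` converges in the Hausdorff distance to a compact
`W ⊆ X`, together with an injective map `h` from `C_x × C_y` into `W` and `L ≥ 1` with
`L⁻¹ |a − b| ≤ |h a − h b| ≤ L |a − b|` on `C_x × C_y`. -/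
theorem lg_weak_tangent (D : LGData) (βx : ℝ) (istar : ℕ) (histar : istar < D.m)
    (hβx_mem : βx ∈ Set.Ioc (0 : ℝ) 1)
    (hβx_eq : ∑ j ∈ Finset.range (D.n istar), D.a istar j ^ βx = 1)
    (hβx_max : ∀ α ∈ Set.Ioc (0 : ℝ) 1,
      (∃ i, i < D.m ∧ ∑ j ∈ Finset.range (D.n i), D.a i j ^ α = 1) → α ≤ βx) :
    ∃ (X W : Set (EuclideanSpace ℝ (Fin 2)))
      (f : ℕ → EuclideanSpace ℝ (Fin 2) → EuclideanSpace ℝ (Fin 2)) (lam : ℕ → ℝ)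
      (h : EuclideanSpace ℝ (Fin 2) → EuclideanSpace ℝ (Fin 2)) (L : ℝ),
      IsCompact X ∧ IsCompact W ∧ W ⊆ X ∧
      (∀ k, 0 < lam k) ∧
      (∀ k x y, dist (f k x) (f k y) = lam k * dist x y) ∧
      Filter.Tendsto (fun k => EMetric.hausdorffEdist ((f k '' lgCarpet D) ∩ X) W)
        Filter.atTop (nhds 0) ∧
      1 ≤ L ∧
      Set.InjOn h {z : EuclideanSpace ℝ (Fin 2) | z 0 ∈ lgCx D istar ∧ z 1 ∈ lgCy D} ∧
      Set.MapsTo h {z : EuclideanSpace ℝ (Fin 2) | z 0 ∈ lgCx D istar ∧ z 1 ∈ lgCy D} W ∧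
      (∀ x ∈ {z : EuclideanSpace ℝ (Fin 2) | z 0 ∈ lgCx D istar ∧ z 1 ∈ lgCy D},
       ∀ y ∈ {z : EuclideanSpace ℝ (Fin 2) | z 0 ∈ lgCx D istar ∧ z 1 ∈ lgCy D},
        L⁻¹ * dist x y ≤ dist (h x) (h y) ∧ dist (h x) (h y) ≤ L * dist x y) := by
  have h0 : 0 < D.n istar := D.hn_one istar histar
  have hb := D.b_pos histar
  choose r hr v s hs happrox using D.exists_magnification histar
  let f : ℕ → EuclideanSpace ℝ (Fin 2) → EuclideanSpace ℝ (Fin 2) :=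
    fun k z => r k • (z - toE (v k))
  have hf : ∀ k, Continuous (f k) := fun k => by fun_prop
  have hX : IsCompact (toE '' LGData.square) :=
    (isCompact_Icc.prod isCompact_Icc).image continuous_toE
  have hS : IsCompact (lgCarpet D) := by
    rw [D.lgCarpet_eq_image]
    exact D.isCompact_attractor.image continuous_toE
  obtain ⟨W, hWX, hW, t, ht, φ, hφ, hlim, hst⟩ :=
    exists_subseq_tendsto_hausdorffEDist hX (fun k => (hS.image (hf k)).isClosed) hs
  have ht0 : 0 < t := hb.trans_le ht.1
  have ht1 : 1 ≤ t⁻¹ := (one_le_inv₀ ht0).2 ht.2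
  have hbilip := dist_toE_mul_snd ht0 ht.2
  refine ⟨toE '' LGData.square, W, fun k => f (φ k), fun k => r (φ k),
    fun z => toE (z 0, t * z 1), t⁻¹, hX, hW, hWX, fun k => hr _, ?_, hlim, ht1, ?_, ?_, ?_⟩
  · intro k x y
    simp only [f, dist_smul₀, dist_sub_right, Real.norm_eq_abs, abs_of_pos (hr _)]
  · intro x _ y _ hxy
    have h1 := (hbilip x y).1
    rw [dist_eq_zero.2 hxy] at h1
    exact dist_le_zero.1 (nonpos_of_mul_nonpos_right h1 ht0)
  · rintro z ⟨hz0, hz1⟩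
    choose x' hx' hmem using fun k => happrox k (z 0) hz0 (z 1) hz1
    have hratio : Tendsto (fun k => (D.a istar 0 / D.b istar) ^ k) atTop (nhds 0) :=
      tendsto_pow_atTop_nhds_zero_of_lt_one (div_pos (D.ha_pos istar histar 0 h0) hb).le
        ((div_lt_one hb).2 (D.ha_lt_b istar histar 0 h0))
    have hx'lim : Tendsto x' atTop (nhds (z 0)) :=
      tendsto_iff_dist_tendsto_zero.2
        (squeeze_zero (fun _ => dist_nonneg) (fun k => hx' k) hratio)
    refine hW.isClosed.mem_of_tendsto_hausdorffEDist hlim (fun k => hmem (φ k)) ?_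
    exact (continuous_toE.tendsto _).comp
      ((hx'lim.comp hφ.tendsto_atTop).prodMk_nhds (hst.mul_const (z 1)))
  · intro x _ y _
    rw [inv_inv]
    exact ⟨(hbilip x y).1, (hbilip x y).2.trans (le_mul_of_one_le_left dist_nonneg ht1)⟩
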